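/- Let Π be an ordered logic program having only static preferences, i.e., Π = Π' ∪ Π'' where Π' is a program containing no preference atoms and Π'' ⊆ {(n_r ≺ n_{r'}) ← | r,r' ∈ Π'}. If X is a consistent answer set of 𝒯(Π), then <_X = <_Y for any answer set Y of 𝒯(Π). -/

import Mathlib

set_option autoImplicit false

namespace ASP

/-- Literals over a set of atoms: an atom or its classical negation. -/
inductive Lit (α : Type) : Type
  | pos : α → Lit α
  | neg : α → Lit α

namespace Lit

/-- The atom of a literal. -/
def atom {α : Type} : Lit α → α
  | pos a => a
  | neg a => a

/-- Map a function over the atom of a literal. -/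
def map {α β : Type} (f : α → β) : Lit α → Lit β
  | pos a => pos (f a)
  | neg a => neg (f a)

end Lit

/-- A rule `head ← bodyP, not bodyN`. -/
structure Rule (α : Type) : Type where
  head : Lit α
  bodyP : Set (Lit α)
  bodyN : Set (Lit α)

/-- Map a function over the atoms of a rule. -/
def Rule.map {α β : Type} (f : α → β) (r : Rule α) : Rule β :=
  ⟨r.head.map f, Lit.map f '' r.bodyP, Lit.map f '' r.bodyN⟩

/-- The literals occurring in a rule. -/
def ruleLits {α : Type} (r : Rule α) : Set (Lit α) := insert r.head (r.bodyP ∪ r.bodyN)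

/-- A set of literals is consistent iff it contains no complementary pair. -/
def consistent {α : Type} (X : Set (Lit α)) : Prop := ¬ ∃ a, Lit.pos a ∈ X ∧ Lit.neg a ∈ X

/-- Logically closed: consistent or the set of all literals. -/
def logClosed {α : Type} (X : Set (Lit α)) : Prop := consistent X ∨ X = Set.univ

/-- The smallest logically closed set of literals containing `S`. -/
def logClosure {α : Type} (S : Set (Lit α)) : Set (Lit α) := ⋂₀ {Y | S ⊆ Y ∧ logClosed Y}

/-- `X` is closed under the (basic) program `P`. -/
def closedUnder {α : Type} (P : Set (Rule α)) (X : Set (Lit α)) : Prop :=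
  ∀ r ∈ P, r.bodyP ⊆ X → r.head ∈ X

/-- `Th P`: smallest set which is logically closed and closed under the basic program `P`. -/
def Th {α : Type} (P : Set (Rule α)) : Set (Lit α) := ⋂₀ {X | logClosed X ∧ closedUnder P X}

/-- A rule is defeated by `X` iff `bodyN r ∩ X ≠ ∅`. -/
def defeated {α : Type} (r : Rule α) (X : Set (Lit α)) : Prop := ∃ L ∈ r.bodyN, L ∈ X

/-- The Gelfond-Lifschitz reduct of `P` relative to `X`. -/
def reduct {α : Type} (P : Set (Rule α)) (X : Set (Lit α)) : Set (Rule α) :=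
  {r' | ∃ r ∈ P, ¬ defeated r X ∧ r' = Rule.mk r.head r.bodyP ∅}

/-- `X` is an answer set of `P` iff `Th (P^X) = X`. -/
def answerSet {α : Type} (P : Set (Rule α)) (X : Set (Lit α)) : Prop := Th (reduct P X) = X

/-- Generating rules of `X` from `P`. -/
def GR {α : Type} (P : Set (Rule α)) (X : Set (Lit α)) : Set (Rule α) :=
  {r | r ∈ P ∧ r.bodyP ⊆ X ∧ ¬ defeated r X}

/-- Heads of the rules occurring before position `i` in the list `l`. -/
def headsBefore {α : Type} (l : List (Rule α)) (i : ℕ) : Set (Lit α) :=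
  {L | L ∈ (l.take i).map Rule.head}

/-- The sequence of rules `l` is grounded. -/
def groundedList {α : Type} (l : List (Rule α)) : Prop :=
  ∀ (i : ℕ) (h : i < l.length),
    consistent (headsBefore l i) → (l.get ⟨i, h⟩).bodyP ⊆ headsBefore l i

/-- `l` is an enumeration of the set `S` of rules. -/
def enumerates {α : Type} (l : List (Rule α)) (S : Set (Rule α)) : Prop :=
  l.Nodup ∧ {r | r ∈ l} = S

/-- The one-step consequence operator for basic programs. -/
def TOp {α : Type} (P : Set (Rule α)) (X : Set (Lit α)) : Set (Lit α) :=
  {L | (consistent X ∧ ∃ r ∈ P, r.bodyP ⊆ X ∧ r.head = L) ∨ ¬ consistent X}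

/-- Iterated application of `TOp`, starting from `∅`. -/
def TIter {α : Type} (P : Set (Rule α)) : ℕ → Set (Lit α)
  | 0 => ∅
  | n + 1 => TOp P (TIter P n)

/-- A strict partial order whose field is contained in `P`. -/
def strictOn {γ : Type} (P : Set γ) (lt : γ → γ → Prop) : Prop :=
  (∀ a b, lt a b → a ∈ P ∧ b ∈ P) ∧ (∀ a b c, lt a b → lt b c → lt a c) ∧ (∀ a, ¬ lt a a)

/-- A total strict order on `P`. -/
def totalStrictOn {γ : Type} (P : Set γ) (ll : γ → γ → Prop) : Prop :=
  (∀ a b, ll a b → a ∈ P ∧ b ∈ P) ∧ (∀ a b c, ll a b → ll b c → ll a c) ∧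
    (∀ a, ¬ ll a a) ∧ (∀ a ∈ P, ∀ b ∈ P, a ≠ b → ll a b ∨ ll b a)

/-! ## Ordered logic programs -/

/-- Atoms of the language of an ordered logic program: regular atoms and
preference atoms `n ≺ m` over names. -/
inductive OAtom (α N : Type) : Type
  | reg : α → OAtom α N
  | pref : N → N → OAtom α N

/-- Rules of an ordered logic program. -/
abbrev ORule (α N : Type) := Rule (OAtom α N)

/-- The preference literal `(n ≺ m)`. -/
def prefLit {α N : Type} (n m : N) : Lit (OAtom α N) := Lit.pos (OAtom.pref n m)

/-- A literal over a regular atom. -/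
def regLitO {α N : Type} (L : Lit (OAtom α N)) : Prop := ∃ a, L.atom = OAtom.reg a

/-- No preference atom occurs in the rule `r`. -/
def noPref {α N : Type} (r : ORule α N) : Prop := ∀ L ∈ ruleLits r, regLitO L

/-- The dynamically induced preference `r <_X r'`, at the level of the language `𝓛`. -/
def precXO {α N : Type} (nm : ORule α N → N) (X : Set (Lit (OAtom α N)))
    (r s : ORule α N) : Prop :=
  prefLit (nm r) (nm s) ∈ X

/-- The fact `(n_r ≺ n_s) ←`. -/
def prefFactO {α N : Type} (nm : ORule α N → N) (r s : ORule α N) : ORule α N :=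
  ⟨prefLit (nm r) (nm s), ∅, ∅⟩

/-- The transitivity rule `t(r,s,t)`. -/
def tRuleO {α N : Type} (nm : ORule α N → N) (r s t : ORule α N) : ORule α N :=
  ⟨prefLit (nm r) (nm t), {prefLit (nm r) (nm s), prefLit (nm s) (nm t)}, ∅⟩

/-- The antisymmetry rule `as(r,s)`. -/
def asRuleO {α N : Type} (nm : ORule α N → N) (r s : ORule α N) : ORule α N :=
  ⟨Lit.neg (OAtom.pref (nm s) (nm r)), {prefLit (nm r) (nm s)}, ∅⟩

/-- `TA(Π)`: `Π` together with all transitivity and antisymmetry rules. -/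
def TA {α N : Type} (P : Set (ORule α N)) (nm : ORule α N → N) : Set (ORule α N) :=
  P ∪ {ru | ∃ r ∈ P, ∃ s ∈ P, ∃ t ∈ P, ru = tRuleO nm r s t}
    ∪ {ru | ∃ r ∈ P, ∃ s ∈ P, ru = asRuleO nm r s}

/-- The statically ordered program `(Π,<)`, identified with
`Π ∪ {(n_r ≺ n_{r'}) ← ∣ r < r'}`. -/
def staticProg {α N : Type} (P : Set (ORule α N)) (nm : ORule α N → N)
    (lt : ORule α N → ORule α N → Prop) : Set (ORule α N) :=
  P ∪ {ru | ∃ r ∈ P, ∃ s ∈ P, lt r s ∧ ru = prefFactO nm r s}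

/-- The heads of the generating rules occurring before position `i` in `l`. -/
def grHeadsBefore {α : Type} (l : List (Rule α)) (G : Set (Rule α)) (i : ℕ) :
    Set (Lit α) :=
  {L | ∃ j, ∃ h : j < l.length, j < i ∧ l.get ⟨j, h⟩ ∈ G ∧ (l.get ⟨j, h⟩).head = L}

/-- `X` is a `<`-preserving answer set of the statically ordered program `(P,lt)`
(Definition 1). -/
def staticPreserving {α N : Type} (P : Set (ORule α N))
    (lt : ORule α N → ORule α N → Prop) (X : Set (Lit (OAtom α N))) : Prop :=
  answerSet P X ∧ consistent X ∧
    ∃ l : List (ORule α N), enumerates l (GR P X) ∧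
      (∀ (i : ℕ) (h : i < l.length), (l.get ⟨i, h⟩).bodyP ⊆ headsBefore l i) ∧
      (∀ (i j : ℕ) (hi : i < l.length) (hj : j < l.length),
        lt (l.get ⟨i, hi⟩) (l.get ⟨j, hj⟩) → j < i) ∧
      (∀ (i : ℕ) (hi : i < l.length), ∀ r' ∈ P, r' ∉ GR P X →
        lt (l.get ⟨i, hi⟩) r' →
          ¬ r'.bodyP ⊆ X ∨ ∃ L ∈ r'.bodyN, L ∈ headsBefore l i)

/-- `X` is a `<_X`-preserving answer set of the program `P` (standing for `TA(Π)`;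
Definition 3). -/
def dynPreserving {α N : Type} (nm : ORule α N → N) (P : Set (ORule α N))
    (X : Set (Lit (OAtom α N))) : Prop :=
  answerSet P X ∧ consistent X ∧
    ∃ l : List (ORule α N), enumerates l P ∧
      (∀ (i j : ℕ) (hi : i < l.length) (hj : j < l.length),
        precXO nm X (l.get ⟨i, hi⟩) (l.get ⟨j, hj⟩) → j < i) ∧
      (∀ (i j : ℕ) (hi : i < l.length) (hj : j < l.length),
        precXO nm X (l.get ⟨i, hi⟩) (l.get ⟨j, hj⟩) →
          ∃ k, ∃ hk : k < l.length, k < i ∧ l.get ⟨k, hk⟩ ∈ GR P X ∧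
            (l.get ⟨k, hk⟩).head = prefLit (nm (l.get ⟨i, hi⟩)) (nm (l.get ⟨j, hj⟩))) ∧
      (∀ (i : ℕ) (hi : i < l.length), l.get ⟨i, hi⟩ ∈ GR P X →
        (l.get ⟨i, hi⟩).bodyP ⊆ grHeadsBefore l (GR P X) i) ∧
      (∀ (i : ℕ) (hi : i < l.length), l.get ⟨i, hi⟩ ∉ GR P X →
        ¬ (l.get ⟨i, hi⟩).bodyP ⊆ X ∨
          ∃ L ∈ (l.get ⟨i, hi⟩).bodyN, L ∈ grHeadsBefore l (GR P X) i)

/-- Occurrence of a name in a rule (inside some preference atom). -/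
def nameOccurs {α N : Type} (n : N) (r : ORule α N) : Prop :=
  ∃ L ∈ ruleLits r, ∃ m, L.atom = OAtom.pref n m ∨ L.atom = OAtom.pref m n

/-! ## The translation 𝒯 -/

/-- Atoms of the target language `𝓛⁺` of the translation `𝒯`. -/
inductive TAtom (α N : Type) : Type
  | old : OAtom α N → TAtom α N
  | ap : N → TAtom α N
  | bl : N → TAtom α N
  | ok : N → TAtom α N
  | rdy : N → N → TAtom α N

/-- Embedding of `𝓛`-literals into `𝓛⁺`. -/
def oldLit {α N : Type} (L : Lit (OAtom α N)) : Lit (TAtom α N) := L.map TAtom.old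

/-- The preference literal `(n ≺ m)` inside `𝓛⁺`. -/
def tpref {α N : Type} (n m : N) : Lit (TAtom α N) := Lit.pos (TAtom.old (OAtom.pref n m))

def apLit {α N : Type} (n : N) : Lit (TAtom α N) := Lit.pos (TAtom.ap n)
def blLit {α N : Type} (n : N) : Lit (TAtom α N) := Lit.pos (TAtom.bl n)
def okLit {α N : Type} (n : N) : Lit (TAtom α N) := Lit.pos (TAtom.ok n)
def rdyLit {α N : Type} (n m : N) : Lit (TAtom α N) := Lit.pos (TAtom.rdy n m)

/-- `a1(r) : head(r) ← ap(n_r)`. -/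
def a1Rule {α N : Type} (nm : ORule α N → N) (r : ORule α N) : Rule (TAtom α N) :=
  ⟨oldLit r.head, {apLit (nm r)}, ∅⟩

/-- `a2(r) : ap(n_r) ← ok(n_r), body(r)`. -/
def a2Rule {α N : Type} (nm : ORule α N → N) (r : ORule α N) : Rule (TAtom α N) :=
  ⟨apLit (nm r), insert (okLit (nm r)) (oldLit '' r.bodyP), oldLit '' r.bodyN⟩

/-- `b1(r,L⁺) : bl(n_r) ← ok(n_r), not L⁺`. -/
def b1Rule {α N : Type} (nm : ORule α N → N) (r : ORule α N) (L : Lit (OAtom α N)) :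
    Rule (TAtom α N) :=
  ⟨blLit (nm r), {okLit (nm r)}, {oldLit L}⟩

/-- `b2(r,L⁻) : bl(n_r) ← ok(n_r), L⁻`. -/
def b2Rule {α N : Type} (nm : ORule α N → N) (r : ORule α N) (L : Lit (OAtom α N)) :
    Rule (TAtom α N) :=
  ⟨blLit (nm r), {okLit (nm r), oldLit L}, ∅⟩

/-- `c1(r) : ok(n_r) ← rdy(n_r,n_{r_1}), …, rdy(n_r,n_{r_k})`. -/
def c1Rule {α N : Type} (P : Set (ORule α N)) (nm : ORule α N → N) (r : ORule α N) :
    Rule (TAtom α N) :=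
  ⟨okLit (nm r), {L | ∃ s ∈ P, L = rdyLit (nm r) (nm s)}, ∅⟩

/-- `c2(r,s) : rdy(n_r,n_s) ← not (n_r ≺ n_s)`. -/
def c2Rule {α N : Type} (nm : ORule α N → N) (r s : ORule α N) : Rule (TAtom α N) :=
  ⟨rdyLit (nm r) (nm s), ∅, {tpref (nm r) (nm s)}⟩

/-- `c3(r,s) : rdy(n_r,n_s) ← (n_r ≺ n_s), ap(n_s)`. -/
def c3Rule {α N : Type} (nm : ORule α N → N) (r s : ORule α N) : Rule (TAtom α N) :=
  ⟨rdyLit (nm r) (nm s), {tpref (nm r) (nm s), apLit (nm s)}, ∅⟩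

/-- `c4(r,s) : rdy(n_r,n_s) ← (n_r ≺ n_s), bl(n_s)`. -/
def c4Rule {α N : Type} (nm : ORule α N → N) (r s : ORule α N) : Rule (TAtom α N) :=
  ⟨rdyLit (nm r) (nm s), {tpref (nm r) (nm s), blLit (nm s)}, ∅⟩

/-- `t(r,s,t) : (n_r ≺ n_t) ← (n_r ≺ n_s), (n_s ≺ n_t)` inside `𝓛⁺`. -/
def tRuleT {α N : Type} (nm : ORule α N → N) (r s t : ORule α N) : Rule (TAtom α N) :=
  ⟨tpref (nm r) (nm t), {tpref (nm r) (nm s), tpref (nm s) (nm t)}, ∅⟩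

/-- `as(r,s) : ¬(n_s ≺ n_r) ← (n_r ≺ n_s)` inside `𝓛⁺`. -/
def asRuleT {α N : Type} (nm : ORule α N → N) (r s : ORule α N) : Rule (TAtom α N) :=
  ⟨Lit.neg (TAtom.old (OAtom.pref (nm s) (nm r))), {tpref (nm r) (nm s)}, ∅⟩

/-- The set of rules `τ(r)` of Definition 2. -/
def tau {α N : Type} (P : Set (ORule α N)) (nm : ORule α N → N) (r : ORule α N) :
    Set (Rule (TAtom α N)) :=
  {a1Rule nm r, a2Rule nm r, c1Rule P nm r}
    ∪ {ru | ∃ L ∈ r.bodyP, ru = b1Rule nm r L}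
    ∪ {ru | ∃ L ∈ r.bodyN, ru = b2Rule nm r L}
    ∪ {ru | ∃ s ∈ P, ru = c2Rule nm r s ∨ ru = c3Rule nm r s ∨ ru = c4Rule nm r s}
    ∪ {ru | ∃ s ∈ P, ∃ t ∈ P, ru = tRuleT nm r s t}
    ∪ {ru | ∃ s ∈ P, ru = asRuleT nm r s}

/-- The translation `𝒯(Π) = ⋃_{r ∈ Π} τ(r)`. -/
def TTrans {α N : Type} (P : Set (ORule α N)) (nm : ORule α N → N) :
    Set (Rule (TAtom α N)) :=
  {ru | ∃ r ∈ P, ru ∈ tau P nm r}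

/-- `𝒯(Π,<)` for a statically ordered program. -/
def TStatic {α N : Type} (P : Set (ORule α N)) (nm : ORule α N → N)
    (lt : ORule α N → ORule α N → Prop) : Set (Rule (TAtom α N)) :=
  TTrans (staticProg P nm lt) nm

/-- The dynamically induced preference `r <_X r'` read off from an answer set of
the translated program. -/
def precX {α N : Type} (nm : ORule α N → N) (X : Set (Lit (TAtom α N)))
    (r s : ORule α N) : Prop :=
  tpref (nm r) (nm s) ∈ X

/-- The literals of `𝓛⁺` over regular atoms (the set `𝓛_𝒜`). -/
def regLitsT {α N : Type} : Set (Lit (TAtom α N)) :=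
  {L | ∃ a, L.atom = TAtom.old (OAtom.reg a)}

/-- The literals of `𝓛⁺` belonging to the original language `𝓛`. -/
def oldLitsT {α N : Type} : Set (Lit (TAtom α N)) := Set.range oldLit

/-- A rule of `𝒯(Π)` that is an "image" of `r ∈ Π`:
`a2(r)`, or `b1(r,L)`/`b2(r,L)` for some body literal `L` of `r`. -/
def imgRule {α N : Type} (nm : ORule α N → N) (r : ORule α N)
    (ru : Rule (TAtom α N)) : Prop :=
  ru = a2Rule nm r ∨ (∃ L ∈ r.bodyP, ru = b1Rule nm r L) ∨
    (∃ L ∈ r.bodyN, ru = b2Rule nm r L)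

/-! ## The translation 𝒰 (Brewka–Eiter encoding) -/

/-- Atoms of the target language `𝓛°` of the translation `𝒰`. -/
inductive UAtom (α N : Type) : Type
  | old : OAtom α N → UAtom α N
  | pr : OAtom α N → UAtom α N
  | ap : N → UAtom α N
  | bl : N → UAtom α N
  | ok : N → UAtom α N
  | rdy : N → N → UAtom α N
  | de : N → UAtom α N

def uold {α N : Type} (L : Lit (OAtom α N)) : Lit (UAtom α N) := L.map UAtom.old
def uprimed {α N : Type} (L : Lit (OAtom α N)) : Lit (UAtom α N) := L.map UAtom.pr
def upref {α N : Type} (n m : N) : Lit (UAtom α N) := Lit.pos (UAtom.old (OAtom.pref n m))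
def uapLit {α N : Type} (n : N) : Lit (UAtom α N) := Lit.pos (UAtom.ap n)
def ublLit {α N : Type} (n : N) : Lit (UAtom α N) := Lit.pos (UAtom.bl n)
def uokLit {α N : Type} (n : N) : Lit (UAtom α N) := Lit.pos (UAtom.ok n)
def urdyLit {α N : Type} (n m : N) : Lit (UAtom α N) := Lit.pos (UAtom.rdy n m)
def udeLit {α N : Type} (n : N) : Lit (UAtom α N) := Lit.pos (UAtom.de n)

/-- `a1(r) : head(r') ← ap(n_r)`. -/
def ua1 {α N : Type} (nm : ORule α N → N) (r : ORule α N) : Rule (UAtom α N) :=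
  ⟨uprimed r.head, {uapLit (nm r)}, ∅⟩

/-- `a2(r) : ap(n_r) ← ok(n_r), body(r), not body⁻(r')`. -/
def ua2 {α N : Type} (nm : ORule α N → N) (r : ORule α N) : Rule (UAtom α N) :=
  ⟨uapLit (nm r), insert (uokLit (nm r)) (uold '' r.bodyP),
    uold '' r.bodyN ∪ uprimed '' r.bodyN⟩

/-- `b1(r,L) : bl(n_r) ← ok(n_r), not L, not L'`. -/
def ub1 {α N : Type} (nm : ORule α N → N) (r : ORule α N) (L : Lit (OAtom α N)) :
    Rule (UAtom α N) :=
  ⟨ublLit (nm r), {uokLit (nm r)}, {uold L, uprimed L}⟩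

/-- `b2(r,K) : bl(n_r) ← ok(n_r), K, K'`. -/
def ub2 {α N : Type} (nm : ORule α N → N) (r : ORule α N) (K : Lit (OAtom α N)) :
    Rule (UAtom α N) :=
  ⟨ublLit (nm r), {uokLit (nm r), uold K, uprimed K}, ∅⟩

/-- `c1(r) : ok(n_r) ← rdy(n_r,n_{r_1}), …, rdy(n_r,n_{r_k})`. -/
def uc1 {α N : Type} (P : Set (ORule α N)) (nm : ORule α N → N) (r : ORule α N) :
    Rule (UAtom α N) :=
  ⟨uokLit (nm r), {L | ∃ s ∈ P, L = urdyLit (nm r) (nm s)}, ∅⟩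

/-- `c2(r,s) : rdy(n_r,n_s) ← not (n_r ≺ n_s)`. -/
def uc2 {α N : Type} (nm : ORule α N → N) (r s : ORule α N) : Rule (UAtom α N) :=
  ⟨urdyLit (nm r) (nm s), ∅, {upref (nm r) (nm s)}⟩

/-- `c3(r,s) : rdy(n_r,n_s) ← (n_r ≺ n_s), ap(n_s)`. -/
def uc3 {α N : Type} (nm : ORule α N → N) (r s : ORule α N) : Rule (UAtom α N) :=
  ⟨urdyLit (nm r) (nm s), {upref (nm r) (nm s), uapLit (nm s)}, ∅⟩

/-- `c4(r,s) : rdy(n_r,n_s) ← (n_r ≺ n_s), bl(n_s)`. -/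
def uc4 {α N : Type} (nm : ORule α N → N) (r s : ORule α N) : Rule (UAtom α N) :=
  ⟨urdyLit (nm r) (nm s), {upref (nm r) (nm s), ublLit (nm s)}, ∅⟩

/-- `c5(r,s,J) : rdy(n_r,n_s) ← head(s), J`. -/
def uc5 {α N : Type} (nm : ORule α N → N) (r s : ORule α N) (J : Lit (OAtom α N)) :
    Rule (UAtom α N) :=
  ⟨urdyLit (nm r) (nm s), {uold s.head, uold J}, ∅⟩

/-- The constraint `de(r) : ← not ok(n_r)`, rendered as
`p_r ← not ok(n_r), not p_r` for the fresh atom `p_r = de(n_r)`. -/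
def ude {α N : Type} (nm : ORule α N → N) (r : ORule α N) : Rule (UAtom α N) :=
  ⟨udeLit (nm r), ∅, {uokLit (nm r), udeLit (nm r)}⟩

/-- Transitivity rule inside `𝓛°`. -/
def utr {α N : Type} (nm : ORule α N → N) (r s t : ORule α N) : Rule (UAtom α N) :=
  ⟨upref (nm r) (nm t), {upref (nm r) (nm s), upref (nm s) (nm t)}, ∅⟩

/-- Antisymmetry rule inside `𝓛°`. -/
def uas {α N : Type} (nm : ORule α N → N) (r s : ORule α N) : Rule (UAtom α N) :=
  ⟨Lit.neg (UAtom.old (OAtom.pref (nm s) (nm r))), {upref (nm r) (nm s)}, ∅⟩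

/-- The set of rules `τ(r)` of Definition 8. -/
def utau {α N : Type} (P : Set (ORule α N)) (nm : ORule α N → N) (r : ORule α N) :
    Set (Rule (UAtom α N)) :=
  {ua1 nm r, ua2 nm r, uc1 P nm r, ude nm r}
    ∪ {ru | ∃ L ∈ r.bodyP, ru = ub1 nm r L}
    ∪ {ru | ∃ K ∈ r.bodyN, ru = ub2 nm r K}
    ∪ {ru | ∃ s ∈ P, ru = uc2 nm r s ∨ ru = uc3 nm r s ∨ ru = uc4 nm r s}
    ∪ {ru | ∃ s ∈ P, ∃ J ∈ s.bodyN, ru = uc5 nm r s J}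
    ∪ {ru | ∃ s ∈ P, ∃ t ∈ P, ru = utr nm r s t}
    ∪ {ru | ∃ s ∈ P, ru = uas nm r s}

/-- The translation `𝒰(Π) = Π ∪ ⋃_{r ∈ Π} τ(r)`. -/
def UTrans {α N : Type} (P : Set (ORule α N)) (nm : ORule α N → N) :
    Set (Rule (UAtom α N)) :=
  (Rule.map UAtom.old) '' P ∪ {ru | ∃ r ∈ P, ru ∈ utau P nm r}

/-- The fact `(n_r ≺ n_s) ←` inside `𝓛°`. -/
def uPrefFact {α N : Type} (nm : ORule α N → N) (r s : ORule α N) : Rule (UAtom α N) :=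
  ⟨upref (nm r) (nm s), ∅, ∅⟩

/-- The literals of `𝓛°` over regular atoms (the set `𝓛_𝒜`). -/
def regLitsU {α N : Type} : Set (Lit (UAtom α N)) :=
  {L | ∃ a, L.atom = UAtom.old (OAtom.reg a)}

/-! ## Brewka–Eiter preferred answer sets -/

/-- `reductBE r = head(r) ← not body⁻(r)`. -/
def reductBE {γ : Type} (r : Rule γ) : Rule γ := ⟨r.head, ∅, r.bodyN⟩

/-- The sequence `X_i` of Definition 5 (for the enumeration `l` and the set `X`). -/
def CSeq {γ : Type} (l : List (Rule γ)) (X : Set (Lit γ)) : ℕ → Set (Lit γ)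
  | 0 => ∅
  | i + 1 =>
    CSeq l X i ∪
      {L | ∃ h : i < l.length,
        ¬ defeated (l.get ⟨i, h⟩) (CSeq l X i) ∧
        ¬ ((l.get ⟨i, h⟩).head ∈ X ∧ defeated (l.get ⟨i, h⟩) X) ∧
        L = (l.get ⟨i, h⟩).head}

/-- The operator `C` of Definition 5. -/
def COp {γ : Type} (l : List (Rule γ)) (X : Set (Lit γ)) : Set (Lit γ) :=
  logClosure (⋃ i, CSeq l X i)

/-- `l` is the enumeration of `P` according to the total order `ll`
(most preferred rule first). -/
def descList {γ : Type} (l : List (Rule γ)) (P : Set (Rule γ))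
    (ll : Rule γ → Rule γ → Prop) : Prop :=
  enumerates l P ∧
    ∀ (i j : ℕ) (hi : i < l.length) (hj : j < l.length), i < j →
      ll (l.get ⟨j, hj⟩) (l.get ⟨i, hi⟩)

/-- `X` is the BE-preferred answer set of the fully ordered prerequisite-free
program `(P,ll)`. -/
def BEPrefPF {γ : Type} (P : Set (Rule γ)) (ll : Rule γ → Rule γ → Prop)
    (X : Set (Lit γ)) : Prop :=
  ∃ l, descList l P ll ∧ COp l X = X

/-- The program `Π_X` of Definition 7. -/
def PiX {γ : Type} (P : Set (Rule γ)) (X : Set (Lit γ)) : Set (Rule γ) :=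
  {r' | ∃ r ∈ P, r.bodyP ⊆ X ∧ r' = reductBE r}

/-- `r` is the `ll`-maximal rule of `P` whose BE-reduct is `a`. -/
def beMax {γ : Type} (P : Set (Rule γ)) (ll : Rule γ → Rule γ → Prop)
    (a r : Rule γ) : Prop :=
  r ∈ P ∧ reductBE r = a ∧ ∀ s ∈ P, reductBE s = a → s = r ∨ ll s r

/-- The inherited order `ll_X` of Definition 7. -/
def llX {γ : Type} (P : Set (Rule γ)) (ll : Rule γ → Rule γ → Prop)
    (a b : Rule γ) : Prop :=
  ∃ r1 r2, beMax P ll a r1 ∧ beMax P ll b r2 ∧ ll r1 r2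

/-- `X` is a BE-preferred answer set of the fully ordered program `(P,ll)`. -/
def BEPrefFull {γ : Type} (P : Set (Rule γ)) (ll : Rule γ → Rule γ → Prop)
    (X : Set (Lit γ)) : Prop :=
  answerSet P X ∧ BEPrefPF (PiX P X) (llX P ll) X

/-- `X` is a BE-preferred answer set of the statically ordered program `(P,lt)`. -/
def BEPreferred {γ : Type} (P : Set (Rule γ)) (lt : Rule γ → Rule γ → Prop)
    (X : Set (Lit γ)) : Prop :=
  ∃ ll, totalStrictOn P ll ∧ (∀ a b, lt a b → ll a b) ∧ BEPrefFull P ll X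

/-- `Th P` is contained in every logically closed set that is closed under `P`. -/
theorem Th_subset {α : Type} {P : Set (Rule α)} {Z : Set (Lit α)}
    (hl : logClosed Z) (hc : closedUnder P Z) : Th P ⊆ Z :=
  Set.sInter_subset_of_mem ⟨hl, hc⟩

/-- `Th P` is closed under `P`. -/
theorem closedUnder_Th {α : Type} (P : Set (Rule α)) : closedUnder P (Th P) := by
  intro r hr hb Z hZ
  exact hZ.2 r hr fun L hL => hb hL Z hZ

theorem logClosed_Th {α : Type} (P : Set (Rule α)) : logClosed (Th P) := by
  by_cases h : ∃ Z, consistent Z ∧ closedUnder P Z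
  · obtain ⟨Z, hZ, hc⟩ := h
    have hsub : Th P ⊆ Z := Th_subset (Or.inl hZ) hc
    exact Or.inl fun ⟨a, h1, h2⟩ => hZ ⟨a, hsub h1, hsub h2⟩
  · refine Or.inr (Set.eq_univ_of_forall fun L Z hZ => ?_)
    rcases hZ.1 with h1 | h1
    · exact absurd ⟨Z, h1, hZ.2⟩ h
    · exact h1 ▸ Set.mem_univ L

/-- An answer set contains the head of every undefeated rule whose prerequisites it contains. -/
theorem answerSet.head_mem {α : Type} {P : Set (Rule α)} {X : Set (Lit α)}
    (h : answerSet P X) {r : Rule α} (hr : r ∈ P) (hd : ¬ defeated r X)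
    (hb : r.bodyP ⊆ X) : r.head ∈ X := by
  have hc := closedUnder_Th (reduct P X)
  rw [h] at hc
  exact hc ⟨r.head, r.bodyP, ∅⟩ ⟨r, hr, hd, rfl⟩ hb

/-- Induction over an answer set: a logically closed set that is closed under the undefeated
rules contains it. -/
theorem answerSet.subset {α : Type} {P : Set (Rule α)} {X Z : Set (Lit α)}
    (h : answerSet P X) (hl : logClosed Z)
    (hc : ∀ r ∈ P, ¬ defeated r X → r.bodyP ⊆ Z → r.head ∈ Z) : X ⊆ Z := by
  have hsub : Th (reduct P X) ⊆ Z := by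
    refine Th_subset hl ?_
    rintro _ ⟨r, hr, hd, rfl⟩ hb
    exact hc r hr hd hb
  rwa [h] at hsub

/-- No answer set of the translation of a nonempty program is the set of all literals. -/
theorem answerSet_TTrans_ne_univ {α N : Type} {P : Set (ORule α N)} {nm : ORule α N → N}
    (hP : P.Nonempty) {Y : Set (Lit (TAtom α N))} (h : answerSet (TTrans P nm) Y) :
    Y ≠ Set.univ := by
  rintro rfl
  obtain ⟨r₀, -⟩ := hP
  refine (h.subset (Z := ∅) (Or.inl (by simp [consistent])) ?_) (Set.mem_univ (okLit (nm r₀)))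
  rintro ru ⟨r, hr, hru⟩ hd hb
  have hN : ru.bodyN = ∅ := by
    by_contra hne
    obtain ⟨L, hL⟩ := Set.nonempty_iff_ne_empty.2 hne
    exact hd ⟨L, hL, Set.mem_univ L⟩
  have hE : ru.bodyP = ∅ := Set.subset_empty_iff.1 hb
  simp only [tau, Set.mem_union, Set.mem_insert_iff, Set.mem_singleton_iff,
    Set.mem_ofPred_eq] at hru
  rcases hru with ((((((rfl | rfl | rfl) | ⟨L, _, rfl⟩) | ⟨L, _, rfl⟩) |
    ⟨s, _, rfl | rfl | rfl⟩) | ⟨s, _, t, _, rfl⟩) | ⟨s, _, rfl⟩)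
  case inl.inl.inl.inl.inl.inr.inr =>
    exact (Set.eq_empty_iff_forall_notMem.1 hE _ ⟨r, hr, rfl⟩).elim
  all_goals
    simp [a1Rule, a2Rule, b1Rule, b2Rule, c2Rule, c3Rule, c4Rule, tRuleT, asRuleT,
      Set.eq_empty_iff_forall_notMem, forall_and] at hE hN

/-- The preferences stated by the facts of `P` between rules of `P'`. -/
def factPref {α N : Type} (P P' : Set (ORule α N)) (nm : ORule α N → N) (n m : N) : Prop :=
  ∃ r ∈ P', ∃ s ∈ P', prefFactO nm r s ∈ P ∧ n = nm r ∧ m = nm s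

/-- In a program with static preferences, an answer set of the translation derives only
preferences in the transitive closure of the stated ones. -/
theorem transGen_of_tpref_mem {α N : Type} {P P' P'' : Set (ORule α N)} {nm : ORule α N → N}
    (hsplit : P = P' ∪ P'') (hreg : ∀ r ∈ P', noPref r)
    (hfacts : P'' ⊆ {ru | ∃ r ∈ P', ∃ s ∈ P', ru = prefFactO nm r s})
    {X : Set (Lit (TAtom α N))} (hX : consistent X) (hAS : answerSet (TTrans P nm) X)
    {n m : N} (h : tpref n m ∈ X) : Relation.TransGen (factPref P P' nm) n m := by
  let Z : Set (Lit (TAtom α N)) :=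
    {L | L ∈ X ∧ ∀ n m, L = tpref n m → Relation.TransGen (factPref P P' nm) n m}
  have hZX : Z ⊆ X := fun L hL => hL.1
  refine (hAS.subset (Z := Z) (Or.inl fun ⟨a, h1, h2⟩ => hX ⟨a, hZX h1, hZX h2⟩) ?_ h).2 n m rfl
  intro ru hru hd hb
  refine ⟨hAS.head_mem hru hd (hb.trans hZX), fun n m hnm => ?_⟩
  obtain ⟨r, hr, hru⟩ := hru
  simp only [tau, Set.mem_union, Set.mem_insert_iff, Set.mem_singleton_iff,
    Set.mem_ofPred_eq] at hru
  rcases hru with ((((((rfl | rfl | rfl) | ⟨L, _, rfl⟩) | ⟨L, _, rfl⟩) |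
    ⟨s, _, rfl | rfl | rfl⟩) | ⟨s, _, t, _, rfl⟩) | ⟨s, _, rfl⟩)
  case inl.inl.inl.inl.inl.inl =>
    have hmem := hr
    rw [hsplit] at hmem
    rcases hmem with hr' | hr'
    · obtain ⟨a, ha⟩ := hreg r hr' r.head (Set.mem_insert _ _)
      change oldLit r.head = tpref n m at hnm
      cases hh : r.head <;> simp_all [Lit.atom, oldLit, Lit.map, tpref]
    · obtain ⟨u, hu, v, hv, rfl⟩ := hfacts hr'
      simp only [a1Rule, prefFactO, oldLit, prefLit, Lit.map, tpref, Lit.pos.injEq,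
        TAtom.old.injEq, OAtom.pref.injEq] at hnm
      exact .single ⟨u, hu, v, hv, hr, hnm.1.symm, hnm.2.symm⟩
  case inl.inr =>
    simp only [tRuleT, tpref, Lit.pos.injEq, TAtom.old.injEq, OAtom.pref.injEq] at hnm
    obtain ⟨rfl, rfl⟩ := hnm
    exact ((hb (Or.inl rfl)).2 _ _ rfl).trans ((hb (Or.inr rfl)).2 _ _ rfl)
  all_goals
    simp [a2Rule, b1Rule, b2Rule, c1Rule, c2Rule, c3Rule, c4Rule, asRuleT, apLit, blLit, okLit,
      rdyLit, tpref] at hnm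

/-- In a program with static preferences, every preference fact is derived by a consistent
answer set of the translation. -/
theorem tpref_mem_of_factPref {α N : Type} {P P' P'' : Set (ORule α N)} {nm : ORule α N → N}
    (hinj : Set.InjOn nm P) (hsplit : P = P' ∪ P'') (hreg : ∀ r ∈ P', noPref r)
    (hfacts : P'' ⊆ {ru | ∃ r ∈ P', ∃ s ∈ P', ru = prefFactO nm r s})
    {X : Set (Lit (TAtom α N))} (hX : consistent X) (hAS : answerSet (TTrans P nm) X)
    {n m : N} (h : factPref P P' nm n m) : tpref n m ∈ X := by
  obtain ⟨u, hu, v, hv, hf, rfl, rfl⟩ := h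
  set f := prefFactO nm u v with hfdef
  have hP' : P' ⊆ P := hsplit ▸ Set.subset_union_left
  have hrdy : ∀ s ∈ P, rdyLit (nm f) (nm s) ∈ X := by
    intro s hs
    refine hAS.head_mem (r := c2Rule nm f s) ⟨f, hf, ?_⟩ ?_ (Set.empty_subset _)
    · exact .inl (.inl (.inr ⟨s, hs, .inl rfl⟩))
    · rintro ⟨L, rfl, hL⟩
      have ht := transGen_of_tpref_mem hsplit hreg hfacts hX hAS hL
      obtain ⟨_, ⟨w, hw, _, _, _, hnw, _⟩, _⟩ := Relation.TransGen.head'_iff.1 ht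
      have hfw : f = w := hinj hf (hP' hw) hnw
      obtain ⟨a, ha⟩ := hreg w hw w.head (Set.mem_insert _ _)
      simp [← hfw, hfdef, prefFactO, prefLit, Lit.atom] at ha
  have hok : okLit (nm f) ∈ X := by
    refine hAS.head_mem (r := c1Rule P nm f) ⟨f, hf, ?_⟩ (by simp [defeated, c1Rule]) ?_
    · exact .inl (.inl (.inl (.inl (.inl (.inr (.inr rfl))))))
    · rintro _ ⟨s, hs, rfl⟩
      exact hrdy s hs
  have hap : apLit (nm f) ∈ X := by
    refine hAS.head_mem (r := a2Rule nm f) ⟨f, hf, ?_⟩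
      (by simp [defeated, a2Rule, hfdef, prefFactO]) ?_
    · exact .inl (.inl (.inl (.inl (.inl (.inr (.inl rfl))))))
    · rintro _ (rfl | ⟨L, hL, rfl⟩)
      · exact hok
      · exact hL.elim
  refine hAS.head_mem (r := a1Rule nm f) ⟨f, hf, ?_⟩ (by simp [defeated, a1Rule]) ?_
  · exact .inl (.inl (.inl (.inl (.inl (.inl rfl)))))
  · rintro _ rfl
    exact hap

/-- In a program with static preferences, the preferences derived by a consistent answer set of
the translation are exactly the transitive closure of the stated ones. -/
theorem tpref_mem_iff_transGen {α N : Type} {P P' P'' : Set (ORule α N)} {nm : ORule α N → N}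
    (hnm : Set.BijOn nm P Set.univ) (hsplit : P = P' ∪ P'') (hreg : ∀ r ∈ P', noPref r)
    (hfacts : P'' ⊆ {ru | ∃ r ∈ P', ∃ s ∈ P', ru = prefFactO nm r s})
    {X : Set (Lit (TAtom α N))} (hX : consistent X) (hAS : answerSet (TTrans P nm) X)
    (n m : N) : tpref n m ∈ X ↔ Relation.TransGen (factPref P P' nm) n m := by
  have hfact {n m : N} (h : factPref P P' nm n m) : tpref n m ∈ X :=
    tpref_mem_of_factPref hnm.injOn hsplit hreg hfacts hX hAS h
  refine ⟨transGen_of_tpref_mem hsplit hreg hfacts hX hAS, fun h => ?_⟩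
  induction h with
  | single h => exact hfact h
  | @tail b c _ hbc ih =>
    obtain ⟨r, hr, rfl⟩ := hnm.surjOn (Set.mem_univ n)
    obtain ⟨s, hs, rfl⟩ := hnm.surjOn (Set.mem_univ b)
    obtain ⟨t, ht, rfl⟩ := hnm.surjOn (Set.mem_univ c)
    refine hAS.head_mem (r := tRuleT nm r s t) ⟨r, hr, .inl (.inr ⟨s, hs, t, ht, rfl⟩)⟩
      (by simp [defeated, tRuleT]) ?_
    rintro _ (rfl | rfl)
    · exact ih
    · exact hfact hbc

theorem stmt3 {α N : Type} (P P' P'' : Set (ORule α N)) (nm : ORule α N → N)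
    (hfin : P.Finite) (hnm : Set.BijOn nm P Set.univ)
    (hsplit : P = P' ∪ P'')
    (hreg : ∀ r ∈ P', noPref r)
    (hfacts : P'' ⊆ {ru | ∃ r ∈ P', ∃ s ∈ P', ru = prefFactO nm r s})
    (X : Set (Lit (TAtom α N))) (hX : consistent X)
    (hAS : answerSet (TTrans P nm) X) :
    ∀ Y, answerSet (TTrans P nm) Y →
      ∀ r ∈ P, ∀ s ∈ P, (precX nm X r s ↔ precX nm Y r s) := by
  intro Y hY r hr s _
  have hYc : consistent Y := by
    have hl := logClosed_Th (reduct (TTrans P nm) Y)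
    rw [hY] at hl
    exact hl.resolve_right (answerSet_TTrans_ne_univ ⟨r, hr⟩ hY)
  exact (tpref_mem_iff_transGen hnm hsplit hreg hfacts hX hAS _ _).trans
    (tpref_mem_iff_transGen hnm hsplit hreg hfacts hYc hY _ _).symm

end ASP
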